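/- arXiv:1906.06497 — 5 statements merged into one kernel-verified Lean document; each statement's English description precedes it below -/
import Mathlib

section
/- Let 0 < α < 1 and for each integer j ≥ 0 let b_j^{(α)} = (-1)^j · α(α-1)⋯(α-j+1)/j! (with b_0^{(α)} = 1) be the coefficients in the power-series expansion (1-ξ)^α = Σ_{j≥0} b_j^{(α)} ξ^j. Then for every integer j ≥ 0 one has |b_j^{(α)}| ≤ e^{2α} (j+1)^{-α-1}. -/
/-- The backward Euler convolution quadrature weights `b_j^(α)`, defined by the
generating-function identity `(1-ξ)^α = Σ_{j≥0} b_j^(α) ξ^j`, i.e.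
`b_j^(α) = (-1)^j · α(α-1)⋯(α-j+1)/j!`. -/
noncomputable def cqWeight (α : ℝ) (j : ℕ) : ℝ :=
  (-1 : ℝ) ^ j * (∏ i ∈ Finset.range j, (α - i)) / (Nat.factorial j)

theorem cqWeight_succ (α : ℝ) (j : ℕ) :
    cqWeight α (j + 1) = cqWeight α j * ((j - α) / (j + 1)) := by
  have h1 : ((j : ℝ) + 1) ≠ 0 := by positivity
  have h2 : (Nat.factorial j : ℝ) ≠ 0 := by positivity
  unfold cqWeight
  rw [Finset.prod_range_succ, Nat.factorial_succ]
  push_cast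
  field_simp
  ring

theorem ratio_mul_rpow_le {α x : ℝ} (hα : 0 ≤ 1 + α) (hx : 0 < x) :
    ((x - 1 - α) / x) * x ^ (-α - 1) ≤ (x + 1) ^ (-α - 1) := by
  have hx1 : 0 < x + 1 := by linarith
  have hlog : Real.log (x + 1) ≤ Real.log x + 1 / x := by
    have h := Real.log_le_sub_one_of_pos (div_pos hx1 hx)
    rw [Real.log_div hx1.ne' hx.ne'] at h
    have : (x + 1) / x - 1 = 1 / x := by field_simp; ring
    linarith
  have hratio : (x - 1 - α) / x ≤ Real.exp (-(1 + α) * (1 / x)) := by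
    have h := Real.add_one_le_exp (-(1 + α) * (1 / x))
    have : (x - 1 - α) / x = -(1 + α) * (1 / x) + 1 := by field_simp; ring
    linarith
  calc ((x - 1 - α) / x) * x ^ (-α - 1)
      ≤ Real.exp (-(1 + α) * (1 / x)) * x ^ (-α - 1) := by gcongr
    _ = Real.exp (-(1 + α) * (1 / x) + Real.log x * (-α - 1)) := by
        rw [Real.rpow_def_of_pos hx, Real.exp_add]
    _ ≤ Real.exp (Real.log (x + 1) * (-α - 1)) := by
        apply Real.exp_le_exp.mpr
        nlinarith [mul_le_mul_of_nonneg_left hlog hα]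
    _ = (x + 1) ^ (-α - 1) := by rw [Real.rpow_def_of_pos hx1]

theorem le_exp_two_mul_mul_two_rpow {α : ℝ} (hα0 : 0 ≤ α) (hα1 : α ≤ 1) :
    α ≤ Real.exp (2 * α) * (2 : ℝ) ^ (-α - 1) := by
  have hlog : Real.log 2 ≤ 1 := by linarith [Real.log_le_sub_one_of_pos (two_pos : (0 : ℝ) < 2)]
  have hpow : Real.exp (-α) ≤ (2 : ℝ) ^ (-α) := by
    rw [Real.rpow_def_of_pos two_pos]
    apply Real.exp_le_exp.mpr
    nlinarith
  have hexp := Real.add_one_le_exp α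
  calc α ≤ Real.exp α / 2 := by linarith
    _ = Real.exp (2 * α) * (Real.exp (-α) / 2) := by
        rw [← mul_div_assoc, ← Real.exp_add]
        ring_nf
    _ ≤ Real.exp (2 * α) * ((2 : ℝ) ^ (-α) / 2) := by gcongr
    _ = Real.exp (2 * α) * (2 : ℝ) ^ (-α - 1) := by
        rw [Real.rpow_sub_one two_ne_zero]

/-- For `0 < α < 1`, the CQ weights satisfy `|b_j^(α)| ≤ e^{2α} (j+1)^{-α-1}`. -/
theorem cq_weight_bound (α : ℝ) (hα0 : 0 < α) (hα1 : α < 1) (j : ℕ) :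
    |cqWeight α j| ≤ Real.exp (2 * α) * ((j : ℝ) + 1) ^ (-α - 1) := by
  rcases j with _ | j
  · simp [cqWeight, hα0.le]
  induction j with
  | zero =>
    have h := le_exp_two_mul_mul_two_rpow hα0.le hα1.le
    have h2 : ((0 + 1 : ℕ) : ℝ) + 1 = 2 := by norm_num
    rw [h2]
    simpa [cqWeight, abs_of_pos hα0] using h
  | succ j ih =>
    have hx : (0 : ℝ) < ((j + 1 : ℕ) : ℝ) + 1 := by positivity
    have hratio : 0 ≤ (((j + 1 : ℕ) : ℝ) - α) / (((j + 1 : ℕ) : ℝ) + 1) := by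
      apply div_nonneg _ hx.le
      push_cast
      linarith [(Nat.cast_nonneg j : (0 : ℝ) ≤ j)]
    have hstep := ratio_mul_rpow_le (α := α) (by linarith) hx
    rw [add_sub_cancel_right] at hstep
    rw [cqWeight_succ, abs_mul, abs_of_nonneg hratio, Nat.cast_succ (j + 1)]
    calc _ ≤ _ := mul_le_mul_of_nonneg_right ih hratio
      _ = Real.exp (2 * α) * _ := by rw [mul_assoc, mul_comm (_ ^ _)]
      _ ≤ _ := mul_le_mul_of_nonneg_left hstep (Real.exp_pos _).le
end

section
/- Let β, γ be real numbers with 0 ≤ β < 1, γ ≥ 0 and γ ≠ 1. Then there exists a constant c > 0, depending only on β and γ, such that for every integer n ≥ 1, Σ_{i=1}^n (n+1-i)^{-β} i^{-γ} ≤ c · n^{max(1-γ,0) - β}. -/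
/-- Partial sums of `i ^ (-s)` for `0 ≤ s < 1`, bounded via the Bernoulli inequality. -/
lemma sum_rpow_neg_le_of_lt_one {s : ℝ} (hs0 : 0 ≤ s) (hs1 : s < 1) (n : ℕ) :
    (1 - s) * ∑ i ∈ Finset.Icc 1 n, (i : ℝ) ^ (-s) ≤ (n : ℝ) ^ (1 - s) := by
  induction n with
  | zero => simp [Real.zero_rpow (sub_pos.2 hs1).ne']
  | succ k ih =>
    rw [Finset.sum_Icc_succ_top (by lia), mul_add]
    have hk : (0 : ℝ) < (k : ℝ) + 1 := by positivity
    have bernoulli : (1 + -((k : ℝ) + 1)⁻¹) ^ (1 - s) ≤ 1 + (1 - s) * -((k : ℝ) + 1)⁻¹ :=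
      rpow_one_add_le_one_add_mul_self
        (neg_le_neg (inv_le_one_of_one_le₀ (by linarith [k.cast_nonneg (α := ℝ)])))
        (by linarith) (by linarith)
    have hratio : 1 + -((k : ℝ) + 1)⁻¹ = k / (k + 1) := by
      field_simp
      ring
    rw [hratio, Real.div_rpow k.cast_nonneg hk.le, div_le_iff₀ (Real.rpow_pos_of_pos hk _)]
      at bernoulli
    have hpow : ((k : ℝ) + 1) ^ (-s) = ((k : ℝ) + 1)⁻¹ * ((k : ℝ) + 1) ^ (1 - s) := by
      rw [← Real.rpow_neg_one, ← Real.rpow_add hk]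
      congr 1
      ring
    push_cast
    rw [hpow]
    linarith

lemma exists_sum_rpow_neg_le {s : ℝ} (hs0 : 0 ≤ s) (hs1 : s ≠ 1) :
    ∃ C : ℝ, 0 < C ∧ ∀ n : ℕ,
      ∑ i ∈ Finset.Icc 1 n, (i : ℝ) ^ (-s) ≤ C * (n : ℝ) ^ max (1 - s) 0 := by
  rcases hs1.lt_or_gt with h | h
  · refine ⟨(1 - s)⁻¹, inv_pos.2 (sub_pos.2 h), fun n => ?_⟩
    rw [max_eq_left (sub_nonneg.2 h.le), le_inv_mul_iff₀ (sub_pos.2 h)]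
    exact sum_rpow_neg_le_of_lt_one hs0 h n
  · have hsum : Summable fun i : ℕ => (i : ℝ) ^ (-s) := Real.summable_nat_rpow.2 (by linarith)
    have hnonneg (i : ℕ) : 0 ≤ (i : ℝ) ^ (-s) := Real.rpow_nonneg i.cast_nonneg _
    refine ⟨∑' i : ℕ, (i : ℝ) ^ (-s), hsum.tsum_pos hnonneg 1 (by simp), fun n => ?_⟩
    rw [max_eq_right (by linarith), Real.rpow_zero, mul_one]
    exact hsum.sum_le_tsum _ fun i _ => hnonneg i

lemma rpow_neg_le_of_le_two_mul {s x N : ℝ} (hs : 0 ≤ s) (hN : 0 < N) (h : N ≤ 2 * x) :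
    x ^ (-s) ≤ 2 ^ s * N ^ (-s) := by
  calc x ^ (-s) ≤ (N / 2) ^ (-s) :=
        Real.rpow_le_rpow_of_nonpos (by positivity) (by linarith) (by linarith)
    _ = 2 ^ s * N ^ (-s) := by
        rw [Real.div_rpow hN.le zero_le_two, Real.rpow_neg zero_le_two, div_inv_eq_mul, mul_comm]

lemma mul_rpow_neg_le {β γ x y N : ℝ} (hβ : 0 ≤ β) (hγ : 0 ≤ γ) (hN : 0 < N)
    (hx : 0 ≤ x) (hy : 0 ≤ y) (h : N ≤ x + y) :
    x ^ (-β) * y ^ (-γ) ≤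
      2 ^ γ * N ^ (-γ) * x ^ (-β) + 2 ^ β * N ^ (-β) * y ^ (-γ) := by
  rcases le_total x y with hxy | hxy
  · have := mul_le_mul_of_nonneg_left (rpow_neg_le_of_le_two_mul hγ hN (x := y) (by linarith))
      (Real.rpow_nonneg hx (-β))
    have : 0 ≤ 2 ^ β * N ^ (-β) * y ^ (-γ) := by positivity
    linarith
  · have := mul_le_mul_of_nonneg_right (rpow_neg_le_of_le_two_mul hβ hN (x := x) (by linarith))
      (Real.rpow_nonneg hy (-γ))
    have : 0 ≤ 2 ^ γ * N ^ (-γ) * x ^ (-β) := by positivity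
    linarith

lemma sum_Icc_one_reflect (f : ℝ → ℝ) (n : ℕ) :
    ∑ i ∈ Finset.Icc 1 n, f ((n : ℝ) + 1 - i) = ∑ i ∈ Finset.Icc 1 n, f i := by
  refine Finset.sum_nbij' (fun i => n + 1 - i) (fun i => n + 1 - i) ?_ ?_ ?_ ?_ ?_
  all_goals intro i hi; rw [Finset.mem_Icc] at hi
  · exact Finset.mem_Icc.2 (by lia)
  · exact Finset.mem_Icc.2 (by lia)
  · lia
  · lia
  · rw [Nat.cast_sub (by lia)]
    push_cast
    rfl

/-- For `0 ≤ β < 1`, `γ ≥ 0`, `γ ≠ 1`, there is a constant `c > 0` depending only on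
`β` and `γ` such that `Σ_{i=1}^n (n+1-i)^{-β} i^{-γ} ≤ c · n^{max(1-γ,0) - β}` for all `n ≥ 1`. -/
theorem sum_weight_bound_one (β γ : ℝ) (hβ0 : 0 ≤ β) (hβ1 : β < 1) (hγ0 : 0 ≤ γ) (hγ1 : γ ≠ 1) :
    ∃ c : ℝ, 0 < c ∧ ∀ n : ℕ, 1 ≤ n →
      ∑ i ∈ Finset.Icc 1 n, ((n : ℝ) + 1 - (i : ℝ)) ^ (-β) * (i : ℝ) ^ (-γ)
        ≤ c * (n : ℝ) ^ (max (1 - γ) 0 - β) := by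
  obtain ⟨B, hB, hBsum⟩ := exists_sum_rpow_neg_le hβ0 hβ1.ne
  obtain ⟨C, hC, hCsum⟩ := exists_sum_rpow_neg_le hγ0 hγ1
  refine ⟨2 ^ γ * B + 2 ^ β * C, by positivity, fun n hn => ?_⟩
  have hn1 : (1 : ℝ) ≤ n := by exact_mod_cast hn
  have hn0 : (0 : ℝ) < n := by linarith
  have hpowβ : (n : ℝ) ^ (-γ) * (n : ℝ) ^ max (1 - β) 0 ≤ (n : ℝ) ^ (max (1 - γ) 0 - β) := by
    rw [← Real.rpow_add hn0, max_eq_left (by linarith : 0 ≤ 1 - β)]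
    exact Real.rpow_le_rpow_of_exponent_le hn1 (by linarith [le_max_left (1 - γ) 0])
  have hpowγ : (n : ℝ) ^ (-β) * (n : ℝ) ^ max (1 - γ) 0 = (n : ℝ) ^ (max (1 - γ) 0 - β) := by
    rw [← Real.rpow_add hn0, neg_add_eq_sub]
  calc ∑ i ∈ Finset.Icc 1 n, ((n : ℝ) + 1 - (i : ℝ)) ^ (-β) * (i : ℝ) ^ (-γ)
      ≤ ∑ i ∈ Finset.Icc 1 n, (2 ^ γ * (n : ℝ) ^ (-γ) * ((n : ℝ) + 1 - (i : ℝ)) ^ (-β) +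
          2 ^ β * (n : ℝ) ^ (-β) * (i : ℝ) ^ (-γ)) := by
        refine Finset.sum_le_sum fun i hi => mul_rpow_neg_le hβ0 hγ0 hn0 ?_ i.cast_nonneg ?_
        · have : (i : ℝ) ≤ n := by exact_mod_cast (Finset.mem_Icc.1 hi).2
          linarith
        · linarith
    _ = 2 ^ γ * (n : ℝ) ^ (-γ) * ∑ i ∈ Finset.Icc 1 n, (i : ℝ) ^ (-β) +
          2 ^ β * (n : ℝ) ^ (-β) * ∑ i ∈ Finset.Icc 1 n, (i : ℝ) ^ (-γ) := by
        rw [Finset.sum_add_distrib, ← Finset.mul_sum, ← Finset.mul_sum,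
          sum_Icc_one_reflect (fun x => x ^ (-β))]
    _ ≤ 2 ^ γ * (n : ℝ) ^ (-γ) * (B * (n : ℝ) ^ max (1 - β) 0) +
          2 ^ β * (n : ℝ) ^ (-β) * (C * (n : ℝ) ^ max (1 - γ) 0) := by
        gcongr
        · exact hBsum n
        · exact hCsum n
    _ = 2 ^ γ * B * ((n : ℝ) ^ (-γ) * (n : ℝ) ^ max (1 - β) 0) +
          2 ^ β * C * ((n : ℝ) ^ (-β) * (n : ℝ) ^ max (1 - γ) 0) := by ring
    _ ≤ 2 ^ γ * B * (n : ℝ) ^ (max (1 - γ) 0 - β) +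
          2 ^ β * C * (n : ℝ) ^ (max (1 - γ) 0 - β) := by
        rw [hpowγ]
        gcongr
    _ = (2 ^ γ * B + 2 ^ β * C) * (n : ℝ) ^ (max (1 - γ) 0 - β) := by ring
end

section
/- Let β be a real number with 0 ≤ β ≤ 1. Then there exists a constant c > 0, depending only on β, such that for every integer n ≥ 1, Σ_{i=1}^n (n+1-i)^{-β} i^{-1} ≤ c · n^{-β} · ln(1+n). -/
theorem rpow_neg_le_rpow_neg_mul_div {β m n : ℝ} (hβ1 : β ≤ 1) (hm : 0 < m) (hmn : m ≤ n) :
    m ^ (-β) ≤ n ^ (-β) * (n / m) := by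
  have hn : 0 < n := hm.trans_le hmn
  calc m ^ (-β) = n ^ (-β) * (n / m) ^ β := by
        rw [Real.div_rpow hn.le hm.le, Real.rpow_neg hm.le, Real.rpow_neg hn.le]
        have := Real.rpow_pos_of_pos hn β
        field_simp
    _ ≤ n ^ (-β) * (n / m) := by
        gcongr
        exact Real.rpow_le_self_of_one_le ((one_le_div hm).2 hmn) hβ1

theorem sum_Icc_inv_reflect (n : ℕ) :
    ∑ i ∈ Finset.Icc 1 n, ((n : ℝ) + 1 - (i : ℝ))⁻¹ = ∑ i ∈ Finset.Icc 1 n, (i : ℝ)⁻¹ := by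
  refine Finset.sum_nbij' (fun i => n + 1 - i) (fun i => n + 1 - i) ?_ ?_ ?_ ?_ ?_
  all_goals intro i hi
  all_goals rw [Finset.mem_Icc] at hi
  · rw [Finset.mem_Icc]; omega
  · rw [Finset.mem_Icc]; omega
  · omega
  · omega
  · rw [Nat.cast_sub (by omega)]; push_cast; rfl

theorem sum_Icc_inv_le_log (n : ℕ) (hn : 1 ≤ n) :
    ∑ i ∈ Finset.Icc 1 n, (i : ℝ)⁻¹ ≤ 3 * Real.log (1 + n) := by
  have hn' : (1 : ℝ) ≤ n := by exact_mod_cast hn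
  have h := harmonic_le_one_add_log n
  rw [harmonic_eq_sum_Icc] at h
  push_cast at h
  have h1 : Real.log n ≤ Real.log (1 + n) := Real.log_le_log (by linarith) (by linarith)
  have h2 : Real.log 2 ≤ Real.log (1 + n) := Real.log_le_log (by norm_num) (by linarith)
  linarith [Real.log_two_gt_d9]

/-- For `0 ≤ β ≤ 1`, there is a constant `c > 0` depending only on `β` such that
`Σ_{i=1}^n (n+1-i)^{-β} i^{-1} ≤ c · n^{-β} ln(1+n)` for all `n ≥ 1`. -/
theorem sum_weight_bound_log (β : ℝ) (hβ0 : 0 ≤ β) (hβ1 : β ≤ 1) :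
    ∃ c : ℝ, 0 < c ∧ ∀ n : ℕ, 1 ≤ n →
      ∑ i ∈ Finset.Icc 1 n, ((n : ℝ) + 1 - (i : ℝ)) ^ (-β) * (i : ℝ)⁻¹
        ≤ c * (n : ℝ) ^ (-β) * Real.log (1 + (n : ℝ)) := by
  refine ⟨6, by norm_num, fun n hn => ?_⟩
  calc ∑ i ∈ Finset.Icc 1 n, ((n : ℝ) + 1 - (i : ℝ)) ^ (-β) * (i : ℝ)⁻¹
      ≤ ∑ i ∈ Finset.Icc 1 n, (n : ℝ) ^ (-β) * (((n : ℝ) + 1 - (i : ℝ))⁻¹ + (i : ℝ)⁻¹) := by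
        refine Finset.sum_le_sum fun i hi => ?_
        rw [Finset.mem_Icc] at hi
        have hi1 : (1 : ℝ) ≤ i := by exact_mod_cast hi.1
        have hin : (i : ℝ) ≤ n := by exact_mod_cast hi.2
        have hi0 : (0 : ℝ) < i := by linarith
        have hm : (0 : ℝ) < (n : ℝ) + 1 - i := by linarith
        calc ((n : ℝ) + 1 - i) ^ (-β) * (i : ℝ)⁻¹
            ≤ (n : ℝ) ^ (-β) * (n / ((n : ℝ) + 1 - i)) * (i : ℝ)⁻¹ := by
              gcongr
              exact rpow_neg_le_rpow_neg_mul_div hβ1 hm (by linarith)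
          _ = (n : ℝ) ^ (-β) * (n / (((n : ℝ) + 1 - i) * i)) := by
              field_simp
          _ ≤ (n : ℝ) ^ (-β) * ((n + 1) / (((n : ℝ) + 1 - i) * i)) := by
              gcongr
              linarith
          _ = (n : ℝ) ^ (-β) * (((n : ℝ) + 1 - i)⁻¹ + (i : ℝ)⁻¹) := by
              rw [inv_add_inv hm.ne' hi0.ne', sub_add_cancel]
    _ = (n : ℝ) ^ (-β) * (2 * ∑ i ∈ Finset.Icc 1 n, (i : ℝ)⁻¹) := by
        rw [← Finset.mul_sum, Finset.sum_add_distrib, sum_Icc_inv_reflect, two_mul]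
    _ ≤ (n : ℝ) ^ (-β) * (2 * (3 * Real.log (1 + n))) := by
        gcongr
        exact sum_Icc_inv_le_log n hn
    _ = 6 * (n : ℝ) ^ (-β) * Real.log (1 + (n : ℝ)) := by ring
end

section
/- Let β, γ be real numbers with β > 1 and γ > 1. Then there exists a constant c > 0, depending only on β and γ, such that for every integer n ≥ 1, Σ_{i=1}^n (n+1-i)^{-β} i^{-γ} ≤ c · n^{-min(β,γ)}. -/
theorem Real.sum_Icc_rpow_neg_le_tsum {s : ℝ} (hs : 1 < s) (n : ℕ) :
    ∑ i ∈ Finset.Icc 1 n, (i : ℝ) ^ (-s) ≤ ∑' i : ℕ, (i : ℝ) ^ (-s) :=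
  (Real.summable_nat_rpow.2 (neg_lt_neg hs)).sum_le_tsum _
    fun i _ => Real.rpow_nonneg i.cast_nonneg _

theorem Real.tsum_nat_rpow_neg_pos {s : ℝ} (hs : 1 < s) : 0 < ∑' i : ℕ, (i : ℝ) ^ (-s) :=
  (Real.summable_nat_rpow.2 (neg_lt_neg hs)).tsum_pos
    (fun i => Real.rpow_nonneg i.cast_nonneg _) 1 (by simp)

/-- Reversing the order of summation in a sum of powers over `1, …, n`. -/
theorem Real.sum_Icc_reflect_rpow (s : ℝ) (n : ℕ) :
    ∑ i ∈ Finset.Icc 1 n, ((n : ℝ) + 1 - (i : ℝ)) ^ s = ∑ i ∈ Finset.Icc 1 n, (i : ℝ) ^ s := by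
  refine Finset.sum_nbij' (fun i => n + 1 - i) (fun i => n + 1 - i) ?_ ?_ ?_ ?_ ?_ <;>
    intro i hi <;> rw [Finset.mem_Icc] at hi
  · rw [Finset.mem_Icc]; omega
  · rw [Finset.mem_Icc]; omega
  · omega
  · omega
  · rw [Nat.cast_sub (by omega)]; push_cast; rfl

/-- If `b` is at least half of `x ≥ 1`, then `b ^ (-γ)` is at most `2 ^ γ * x ^ (-m)` for
`m ≤ γ`. -/
theorem Real.rpow_neg_le_of_half_le {x b m γ : ℝ} (hx : 1 ≤ x) (hb : x / 2 ≤ b) (hγ : 0 ≤ γ)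
    (hm : m ≤ γ) : b ^ (-γ) ≤ 2 ^ γ * x ^ (-m) := by
  have hx0 : 0 < x := by linarith
  calc b ^ (-γ) ≤ (x / 2) ^ (-γ) :=
        Real.rpow_le_rpow_of_nonpos (by positivity) hb (neg_nonpos.2 hγ)
    _ = 2 ^ γ * x ^ (-γ) := by
        rw [Real.div_rpow hx0.le zero_le_two, Real.rpow_neg zero_le_two, div_inv_eq_mul, mul_comm]
    _ ≤ 2 ^ γ * x ^ (-m) := by
        gcongr

theorem Real.rpow_neg_mul_rpow_neg_le {x a b β γ : ℝ} (hx : 1 ≤ x) (ha : 0 ≤ a) (hb : 0 ≤ b)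
    (hab : x ≤ a + b) (hβ : 0 ≤ β) (hγ : 0 ≤ γ) :
    a ^ (-β) * b ^ (-γ) ≤
      (2 ^ γ * a ^ (-β) + 2 ^ β * b ^ (-γ)) * x ^ (-min β γ) := by
  have ha' : 0 ≤ a ^ (-β) := Real.rpow_nonneg ha _
  have hb' : 0 ≤ b ^ (-γ) := Real.rpow_nonneg hb _
  have hx' : 0 ≤ x ^ (-min β γ) := Real.rpow_nonneg (by linarith) _
  rw [add_mul]
  rcases le_total (x / 2) b with h | h
  · refine le_add_of_le_of_nonneg ?_ (by positivity)
    have := mul_le_mul_of_nonneg_left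
      (Real.rpow_neg_le_of_half_le hx h hγ (min_le_right β γ)) ha'
    linarith
  · refine le_add_of_nonneg_of_le (by positivity) ?_
    have := mul_le_mul_of_nonneg_right
      (Real.rpow_neg_le_of_half_le hx (by linarith : x / 2 ≤ a) hβ (min_le_left β γ)) hb'
    linarith

/-- For `β > 1` and `γ > 1`, there is a constant `c > 0` depending only on `β` and `γ` such
that `Σ_{i=1}^n (n+1-i)^{-β} i^{-γ} ≤ c · n^{-min(β,γ)}` for all `n ≥ 1`. -/
theorem sum_weight_bound_two (β γ : ℝ) (hβ : 1 < β) (hγ : 1 < γ) :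
    ∃ c : ℝ, 0 < c ∧ ∀ n : ℕ, 1 ≤ n →
      ∑ i ∈ Finset.Icc 1 n, ((n : ℝ) + 1 - (i : ℝ)) ^ (-β) * (i : ℝ) ^ (-γ)
        ≤ c * (n : ℝ) ^ (-min β γ) := by
  have hβT := Real.tsum_nat_rpow_neg_pos hβ
  have hγT := Real.tsum_nat_rpow_neg_pos hγ
  refine ⟨2 ^ γ * ∑' i : ℕ, (i : ℝ) ^ (-β) + 2 ^ β * ∑' i : ℕ, (i : ℝ) ^ (-γ), by positivity,
    fun n hn => ?_⟩
  calc ∑ i ∈ Finset.Icc 1 n, ((n : ℝ) + 1 - (i : ℝ)) ^ (-β) * (i : ℝ) ^ (-γ)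
      ≤ ∑ i ∈ Finset.Icc 1 n, (2 ^ γ * ((n : ℝ) + 1 - (i : ℝ)) ^ (-β) + 2 ^ β * (i : ℝ) ^ (-γ))
          * (n : ℝ) ^ (-min β γ) := by
        refine Finset.sum_le_sum fun i hi => ?_
        have hi' : (i : ℝ) ≤ n := Nat.cast_le.2 (Finset.mem_Icc.1 hi).2
        exact Real.rpow_neg_mul_rpow_neg_le (Nat.one_le_cast.2 hn) (by linarith) i.cast_nonneg
          (by linarith) (by linarith) (by linarith)
    _ = (2 ^ γ * ∑ i ∈ Finset.Icc 1 n, (i : ℝ) ^ (-β)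
          + 2 ^ β * ∑ i ∈ Finset.Icc 1 n, (i : ℝ) ^ (-γ)) * (n : ℝ) ^ (-min β γ) := by
        rw [← Finset.sum_mul, Finset.sum_add_distrib, ← Finset.mul_sum, ← Finset.mul_sum,
          Real.sum_Icc_reflect_rpow]
    _ ≤ _ := by
        gcongr
        · exact Real.sum_Icc_rpow_neg_le_tsum hβ n
        · exact Real.sum_Icc_rpow_neg_le_tsum hγ n
end

section
/- Let 0 < α < 1 and 1 < p < ∞. There exists a constant c > 0, depending only on α and p, with the following property. Let V be a nontrivial finite-dimensional complex inner product space, A : V → V a self-adjoint positive definite linear operator, τ > 0, N ≥ 1, and f^1, …, f^N ∈ V. Define U^0 = 0 and, for 1 ≤ n ≤ N, let U^n ∈ V solve the backward Euler CQ scheme ∂̄_τ^α U^n + A U^n = f^n, where ∂̄_τ^α U^n = τ^{-α} Σ_{j=0}^n b_j^{(α)} U^{n-j}. Then for every 1 ≤ n ≤ N, (τ Σ_{j=1}^n ‖∂̄_τ^α U^j‖^p)^{1/p} + (τ Σ_{j=1}^n ‖A U^j‖^p)^{1/p} ≤ c · (τ Σ_{j=1}^n ‖f^j‖^p)^{1/p}.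 -/
open scoped ComplexInnerProductSpace

/-- The backward Euler CQ approximation `∂̄_τ^α φ^n = τ^{-α} Σ_{j=0}^n b_j^(α) φ^{n-j}`. -/
noncomputable def cqDeriv (α : ℝ) {V : Type} [AddCommGroup V] [Module ℝ V]
    (τ : ℝ) (φ : ℕ → V) (n : ℕ) : V :=
  τ ^ (-α) • ∑ j ∈ Finset.range (n + 1), cqWeight α j • φ (n - j)

lemma cqWeight_zero (α : ℝ) : cqWeight α 0 = 1 := by simp [cqWeight]

lemma add_one_mul_cqWeight_succ (α : ℝ) (j : ℕ) :
    (j + 1) * cqWeight α (j + 1) = (j - α) * cqWeight α j := by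
  have : (Nat.factorial j : ℝ) ≠ 0 := by positivity
  rw [cqWeight, cqWeight, Finset.prod_range_succ, Nat.factorial_succ, pow_succ]
  push_cast
  field_simp
  ring

lemma cqWeight_succ_nonpos {α : ℝ} (hα0 : 0 ≤ α) (hα1 : α ≤ 1) (j : ℕ) :
    cqWeight α (j + 1) ≤ 0 := by
  induction j with
  | zero =>
    have := add_one_mul_cqWeight_succ α 0
    simp only [cqWeight_zero, Nat.cast_zero, zero_add, zero_sub, one_mul, mul_one] at this
    rw [this]; linarith
  | succ j ih =>
    have h := add_one_mul_cqWeight_succ α (j + 1)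
    push_cast at h
    have hj : (0 : ℝ) ≤ j := by positivity
    nlinarith

lemma mul_sum_cqWeight (α : ℝ) (n : ℕ) :
    α * ∑ j ∈ Finset.range (n + 1), cqWeight α j = -((n + 1) * cqWeight α (n + 1)) := by
  induction n with
  | zero =>
    have := add_one_mul_cqWeight_succ α 0
    simp [cqWeight_zero] at this ⊢
    linarith
  | succ n ih =>
    rw [Finset.sum_range_succ, mul_add, ih, add_one_mul_cqWeight_succ α (n + 1)]
    push_cast
    ring

lemma sum_cqWeight_nonneg {α : ℝ} (hα0 : 0 < α) (hα1 : α ≤ 1) (n : ℕ) :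
    0 ≤ ∑ j ∈ Finset.range (n + 1), cqWeight α j := by
  have h := mul_sum_cqWeight α n
  have hb := cqWeight_succ_nonpos hα0.le hα1 n
  have : 0 ≤ α * ∑ j ∈ Finset.range (n + 1), cqWeight α j := by
    rw [h, neg_nonneg]
    exact mul_nonpos_of_nonneg_of_nonpos (by positivity) hb
  exact nonneg_of_mul_nonneg_right this hα0

section ResolventKernel

open PowerSeries

/-- The generating function `(1 - X)^α` of the weights. -/
noncomputable def cqSeries (α : ℝ) : ℝ⟦X⟧ := mk (cqWeight α)

lemma one_sub_X_mul_derivative_cqSeries (α : ℝ) :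
    (1 - X) * d⁄dX ℝ (cqSeries α) = -(C α * cqSeries α) := by
  ext n
  rw [sub_mul, one_mul, map_sub, map_neg, coeff_C_mul, coeff_derivative, cqSeries, coeff_mk,
    coeff_mk]
  rcases n with _ | n
  · have := add_one_mul_cqWeight_succ α 0
    simp [cqWeight_zero] at this ⊢
    linarith
  · rw [coeff_succ_X_mul, coeff_derivative, coeff_mk]
    have := add_one_mul_cqWeight_succ α (n + 1)
    push_cast at this ⊢
    linarith

/-- The generating function `μ / ((1 - X)^α + μ)` of the discrete resolvent kernel. -/
noncomputable def resolventSeries (α μ : ℝ) : ℝ⟦X⟧ := C μ * (cqSeries α + C μ)⁻¹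

/-- The coefficients of `resolventSeries`. -/
noncomputable def resolventKernel (α μ : ℝ) (n : ℕ) : ℝ := coeff n (resolventSeries α μ)

variable {α μ : ℝ}

lemma resolventSeries_mul (hμ : 0 < μ) :
    resolventSeries α μ * (cqSeries α + C μ) = C μ := by
  rw [resolventSeries, mul_assoc, PowerSeries.inv_mul_cancel, mul_one]
  simp only [cqSeries, map_add, ← coeff_zero_eq_constantCoeff_apply, coeff_mk,
    cqWeight_zero, coeff_zero_C]
  positivity

lemma resolventSeries_mul_cqSeries (hμ : 0 < μ) :
    resolventSeries α μ * cqSeries α = C μ * (1 - resolventSeries α μ) := by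
  linear_combination resolventSeries_mul (α := α) hμ

lemma one_sub_X_mul_derivative_resolventSeries (hμ : 0 < μ) :
    (1 - X) * d⁄dX ℝ (resolventSeries α μ)
      = C α * (resolventSeries α μ - resolventSeries α μ ^ 2) := by
  have hne : cqSeries α + C μ ≠ 0 := fun h => by
    have := resolventSeries_mul (α := α) hμ
    rw [h, mul_zero] at this
    have := congrArg (coeff 0) this
    simp [coeff_zero_C] at this
    exact hμ.ne this
  refine mul_right_cancel₀ hne ?_
  have h1 := resolventSeries_mul (α := α) hμ
  have h2 := congrArg (d⁄dX ℝ) h1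
  rw [Derivation.leibniz, map_add, derivative_C, add_zero, smul_eq_mul,
    smul_eq_mul] at h2
  have h3 := one_sub_X_mul_derivative_cqSeries α
  linear_combination (1 - X) * h2 - resolventSeries α μ * h3 + C α * resolventSeries α μ * h1

lemma add_one_mul_resolventKernel_succ (hμ : 0 < μ) (n : ℕ) :
    (n + 1) * resolventKernel α μ (n + 1) = (n + α) * resolventKernel α μ n
      - α * ∑ x ∈ Finset.HasAntidiagonal.antidiagonal n,
          resolventKernel α μ x.1 * resolventKernel α μ x.2 := by
  have h := congrArg (coeff n) (one_sub_X_mul_derivative_resolventSeries (α := α) hμ)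
  rw [sub_mul, one_mul, map_sub, coeff_derivative, coeff_C_mul, map_sub, pow_two] at h
  simp only [resolventKernel]
  rw [← coeff_mul]
  rcases n with _ | n
  · simp at h ⊢
    linarith
  · rw [coeff_succ_X_mul, coeff_derivative] at h
    push_cast at h ⊢
    linarith

lemma resolventKernel_nonneg (hα0 : 0 < α) (hα1 : α < 1) (hμ : 0 < μ) (n : ℕ) :
    0 ≤ resolventKernel α μ n := by
  induction n using Nat.strong_induction_on with
  | _ n ih =>
    have h := congrArg (coeff n) (resolventSeries_mul (α := α) hμ)
    rw [mul_comm, add_mul, map_add, coeff_C_mul, coeff_mul,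
      Finset.Nat.sum_antidiagonal_eq_sum_range_succ
        (fun i j => coeff i (cqSeries α) * coeff j (resolventSeries α μ)),
      Finset.sum_range_succ'] at h
    simp only [cqSeries, coeff_mk, cqWeight_zero, one_mul, Nat.sub_zero] at h
    have hneg : ∑ i ∈ Finset.range n, cqWeight α (i + 1) *
        coeff (n - (i + 1)) (resolventSeries α μ) ≤ 0 :=
      Finset.sum_nonpos fun i hi => mul_nonpos_of_nonpos_of_nonneg
        (cqWeight_succ_nonpos hα0.le hα1.le i) (ih _ (by have := Finset.mem_range.1 hi; lia))
    have hC : 0 ≤ coeff n (C μ : ℝ⟦X⟧) := by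
      rw [coeff_C]; split_ifs <;> linarith
    have : 0 ≤ (1 + μ) * resolventKernel α μ n := by
      rw [resolventKernel]; linarith
    exact nonneg_of_mul_nonneg_right this (by positivity)

lemma resolventKernel_antitone (hα0 : 0 < α) (hα1 : α < 1) (hμ : 0 < μ) :
    Antitone (resolventKernel α μ) := by
  refine antitone_nat_of_succ_le fun n => ?_
  have h := add_one_mul_resolventKernel_succ (α := α) hμ n
  have hk := resolventKernel_nonneg hα0 hα1 hμ
  have hs : 0 ≤ ∑ x ∈ Finset.HasAntidiagonal.antidiagonal n,
      resolventKernel α μ x.1 * resolventKernel α μ x.2 :=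
    Finset.sum_nonneg fun x _ => mul_nonneg (hk _) (hk _)
  have hn : (0 : ℝ) < n + 1 := by positivity
  refine le_of_mul_le_mul_left ?_ hn
  nlinarith [hk n]

lemma sum_resolventKernel_le_one (hα0 : 0 < α) (hα1 : α < 1) (hμ : 0 < μ) (n : ℕ) :
    ∑ i ∈ Finset.range n, resolventKernel α μ i ≤ 1 := by
  have hk := resolventKernel_nonneg hα0 hα1 hμ
  rcases n with _ | n
  · simp
  have coeff_mul_one (f : ℝ⟦X⟧) (m : ℕ) :
      coeff m (f * mk fun _ => (1 : ℝ)) = ∑ i ∈ Finset.range (m + 1), coeff i f := by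
    rw [coeff_mul, Finset.Nat.sum_antidiagonal_eq_sum_range_succ
      (fun i j => coeff i f * coeff j (mk fun _ => (1 : ℝ)))]
    simp
  have h := congrArg (fun f => coeff n (f * mk fun _ => (1 : ℝ)))
    (resolventSeries_mul_cqSeries (α := α) hμ)
  simp only [mul_assoc] at h
  rw [coeff_C_mul, coeff_mul_one, coeff_mul] at h
  have hpos : 0 ≤ μ * ∑ i ∈ Finset.range (n + 1), coeff i (1 - resolventSeries α μ) := by
    rw [← h]
    refine Finset.sum_nonneg fun x _ => mul_nonneg (hk _) ?_
    rw [coeff_mul_one]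
    simpa [cqSeries] using sum_cqWeight_nonneg hα0 hα1.le x.2
  have := nonneg_of_mul_nonneg_right hpos hμ
  simp only [map_sub, Finset.sum_sub_distrib, coeff_one, Finset.sum_ite_eq', Finset.mem_range,
    Nat.zero_lt_succ, if_true] at this
  simpa [resolventKernel] using this

/-- The resolvent kernel solves the scalar scheme. -/
lemma mul_eq_sum_resolventKernel (hμ : 0 < μ) {L : ℕ} {u φ : ℕ → ℂ} (hu : u 0 = 0)
    (h : ∀ n < L, ∑ j ∈ Finset.range (n + 2), (cqWeight α j : ℂ) * u (n + 1 - j)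
      + μ * u (n + 1) = φ n) {n : ℕ} (hn : n < L) :
    μ * u (n + 1) = ∑ j ∈ Finset.range (n + 1), (resolventKernel α μ (n - j) : ℂ) * φ j := by
  set Y := PowerSeries.map Complex.ofRealHom (cqSeries α + C μ) with hY
  set K := PowerSeries.map Complex.ofRealHom (resolventSeries α μ) with hK
  have hKY : K * Y = C (μ : ℂ) := by
    rw [hK, hY, ← map_mul, resolventSeries_mul hμ]
    simp
  have hYu (m : ℕ) : coeff m (Y * mk u)
      = ∑ j ∈ Finset.range (m + 1), (cqWeight α j : ℂ) * u (m - j) + μ * u m := by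
    have : Y = PowerSeries.map Complex.ofRealHom (cqSeries α) + C (μ : ℂ) := by simp [hY]
    rw [this, add_mul, map_add, coeff_C_mul, coeff_mul,
      Finset.Nat.sum_antidiagonal_eq_sum_range_succ
        (fun i j => coeff i (PowerSeries.map Complex.ofRealHom (cqSeries α)) * coeff j (mk u))]
    simp [cqSeries]
  have hc := congrArg (coeff (n + 1)) (show C (μ : ℂ) * mk u = Y * mk u * K by
    rw [← hKY]; ring)
  rw [coeff_C_mul, coeff_mk, coeff_mul, Finset.Nat.sum_antidiagonal_eq_sum_range_succ
      (fun i j => coeff i (Y * mk u) * coeff j K), Finset.sum_range_succ', hYu 0] at hc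
  rw [hc]
  simp only [zero_add, Finset.sum_range_one, hu, mul_zero, zero_mul, add_zero, Nat.sub_zero]
  refine Finset.sum_congr rfl fun j hj => ?_
  have hj := Finset.mem_range.1 hj
  rw [hYu, h j (by lia), mul_comm]
  simp [hK, resolventKernel]
end ResolventKernel

lemma le_rpow_mul_of_le_mul_rpow {p q A B c : ℝ} (h : p.HolderConjugate q) (hA : 0 ≤ A)
    (hB : 0 ≤ B) (hc : 0 ≤ c) (hle : A ≤ c * (A ^ (1 / q) * B ^ (1 / p))) :
    A ≤ c ^ p * B := by
  rcases hA.eq_or_lt with rfl | hA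
  · positivity
  have hp := h.pos
  have hsplit : A = A ^ (1 / p) * A ^ (1 / q) := by
    rw [← Real.rpow_add hA, one_div, one_div, h.inv_add_inv_eq_one, Real.rpow_one]
  have hq : 0 < A ^ (1 / q) := by positivity
  have hroot : A ^ (1 / p) ≤ c * B ^ (1 / p) := by
    refine le_of_mul_le_mul_right ?_ hq
    calc A ^ (1 / p) * A ^ (1 / q) = A := hsplit.symm
      _ ≤ _ := hle
      _ = _ := by ring
  calc A = (A ^ (1 / p)) ^ p := by
        rw [← Real.rpow_mul hA.le, one_div_mul_cancel hp.ne', Real.rpow_one]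
    _ ≤ (c * B ^ (1 / p)) ^ p := by gcongr
    _ = c ^ p * B := by
        rw [Real.mul_rpow hc (by positivity), ← Real.rpow_mul hB, one_div_mul_cancel hp.ne',
          Real.rpow_one]

open MeasureTheory Set in
lemma integral_indicator_rpow_sub {r M : ℝ} (hr : 1 < r) (hM : 0 ≤ M) (g : ℝ) :
    IntegrableOn ((Iio M).indicator fun t : ℝ => t ^ (r - 1) - g * t ^ (r - 2)) (Ioi 0) ∧
    ∫ t in Ioi (0 : ℝ), (Iio M).indicator (fun t : ℝ => t ^ (r - 1) - g * t ^ (r - 2)) t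
      = M ^ r / r - g * (M ^ (r - 1) / (r - 1)) := by
  have hint₁ : IntervalIntegrable (fun t : ℝ => t ^ (r - 1)) volume 0 M :=
    intervalIntegral.intervalIntegrable_rpow' (by linarith)
  have hint₂ : IntervalIntegrable (fun t : ℝ => g * t ^ (r - 2)) volume 0 M :=
    (intervalIntegral.intervalIntegrable_rpow' (by linarith)).const_mul g
  have hset : Iio M ∩ Ioi 0 = Ioo 0 M := by ext; simp [and_comm]
  constructor
  · rw [IntegrableOn, integrable_indicator_iff measurableSet_Iio, IntegrableOn,
      Measure.restrict_restrict measurableSet_Iio, hset]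
    have := (hint₁.sub hint₂).1
    exact this.mono_set Ioo_subset_Ioc_self
  · rw [integral_indicator measurableSet_Iio, Measure.restrict_restrict measurableSet_Iio, hset,
      ← integral_Ioc_eq_integral_Ioo, ← intervalIntegral.integral_of_le hM,
      intervalIntegral.integral_sub hint₁ hint₂, intervalIntegral.integral_const_mul,
      integral_rpow (Or.inl (by linarith)), integral_rpow (Or.inl (by linarith))]
    rw [show r - 1 + 1 = r by ring, show r - 2 + 1 = r - 1 by ring,
      Real.zero_rpow (by linarith), Real.zero_rpow (by linarith)]
    ring

open MeasureTheory Set in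
/-- The layer-cake step of Doob's inequality: a weak-type bound of `M` by `g` on the superlevel
sets of `M` integrates to a bound of the `r`-th moment of `M`. -/
lemma sum_rpow_le_of_weak_type {ι : Type*} (S : Finset ι) {M g : ι → ℝ} {r : ℝ} (hr : 1 < r)
    (hM : ∀ n ∈ S, 0 ≤ M n)
    (hweak : ∀ t : ℝ, 0 < t → 0 ≤ ∑ n ∈ S with t < M n, (g n - t)) :
    ∑ n ∈ S, M n ^ r ≤ r / (r - 1) * ∑ n ∈ S, g n * M n ^ (r - 1) := by
  have key : ∫ t in Ioi (0 : ℝ), ∑ n ∈ S, (Iio (M n)).indicator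
      (fun t : ℝ => t ^ (r - 1) - g n * t ^ (r - 2)) t ≤ 0 := by
    refine setIntegral_nonpos measurableSet_Ioi fun t (ht : 0 < t) => ?_
    have : ∑ n ∈ S, (Iio (M n)).indicator (fun t : ℝ => t ^ (r - 1) - g n * t ^ (r - 2)) t
        = -(t ^ (r - 2) * ∑ n ∈ S with t < M n, (g n - t)) := by
      rw [Finset.sum_filter, Finset.mul_sum, ← Finset.sum_neg_distrib]
      refine Finset.sum_congr rfl fun n _ => ?_
      simp only [indicator_apply, mem_Iio]
      split_ifs
      · rw [show r - 1 = r - 2 + 1 by ring, Real.rpow_add_one ht.ne']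
        ring
      · simp
    rw [this]
    have := hweak t ht
    have : 0 < t ^ (r - 2) := by positivity
    rw [neg_nonpos]
    positivity
  rw [integral_finsetSum _ fun n hn => (integral_indicator_rpow_sub hr (hM n hn) (g n)).1,
    Finset.sum_congr rfl fun n hn => (integral_indicator_rpow_sub hr (hM n hn) (g n)).2,
    Finset.sum_sub_distrib, ← Finset.sum_div] at key
  have hr0 : 0 < r := by linarith
  have hr1 : 0 < r - 1 := by linarith
  have hrw : ∑ n ∈ S, g n * (M n ^ (r - 1) / (r - 1))
      = (∑ n ∈ S, g n * M n ^ (r - 1)) / (r - 1) := by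
    rw [Finset.sum_div]
    exact Finset.sum_congr rfl fun _ _ => by ring
  rw [hrw, sub_nonpos, div_le_iff₀ hr0] at key
  calc _ ≤ _ := key
    _ = _ := by ring

/-- The positive part of the largest sum of `g - t` over a window ending just before `m`. -/
noncomputable def maxExcess (g : ℕ → ℝ) (t : ℝ) : ℕ → ℝ
  | 0 => 0
  | m + 1 => max 0 (g m - t + maxExcess g t m)

lemma maxExcess_nonneg (g : ℕ → ℝ) (t : ℝ) (m : ℕ) : 0 ≤ maxExcess g t m := by
  cases m <;> simp [maxExcess]

lemma sum_window_le_maxExcess (g : ℕ → ℝ) (t : ℝ) (m j : ℕ) (hj : j ≤ m) :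
    ∑ i ∈ Finset.range (j + 1), (g (m - i) - t) ≤ maxExcess g t (m + 1) := by
  induction m generalizing j with
  | zero =>
    obtain rfl : j = 0 := by lia
    simp [maxExcess]
  | succ m ih =>
    rw [Finset.sum_range_succ', maxExcess]
    refine le_max_of_le_right ?_
    rcases j with _ | j
    · have := maxExcess_nonneg g t (m + 1)
      simpa using this
    · have := ih j (by lia)
      simp only [Nat.add_sub_add_right, Nat.sub_zero]
      linarith

lemma exists_sum_window_eq_maxExcess (g : ℕ → ℝ) (t : ℝ) (m : ℕ)
    (hm : 0 < maxExcess g t (m + 1)) :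
    ∃ j ≤ m, ∑ i ∈ Finset.range (j + 1), (g (m - i) - t) = maxExcess g t (m + 1) := by
  induction m with
  | zero =>
    refine ⟨0, le_rfl, ?_⟩
    rw [maxExcess] at hm ⊢
    have : 0 < g 0 - t + maxExcess g t 0 := by simpa using hm
    rw [max_eq_right this.le]
    simp [maxExcess]
  | succ m ih =>
    rw [maxExcess] at hm ⊢
    have hpos : 0 < g (m + 1) - t + maxExcess g t (m + 1) := by simpa using hm
    rw [max_eq_right hpos.le]
    rcases (maxExcess_nonneg g t (m + 1)).eq_or_lt with h0 | h0
    · exact ⟨0, by lia, by simp [← h0]⟩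
    · obtain ⟨j, hj, hsum⟩ := ih h0
      refine ⟨j + 1, by lia, ?_⟩
      rw [Finset.sum_range_succ', ← hsum]
      simp only [Nat.add_sub_add_right, Nat.sub_zero]
      ring

/-- The one-sided discrete Hardy–Littlewood maximal function. -/
noncomputable def leftMaximal (g : ℕ → ℝ) (m : ℕ) : ℝ :=
  (Finset.range (m + 1)).sup' Finset.nonempty_range_add_one fun j =>
    (∑ i ∈ Finset.range (j + 1), g (m - i)) / (j + 1)

lemma sum_window_le_leftMaximal (g : ℕ → ℝ) {m j : ℕ} (hj : j ≤ m) :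
    ∑ i ∈ Finset.range (j + 1), g (m - i) ≤ (j + 1) * leftMaximal g m := by
  rw [← div_le_iff₀' (by positivity)]
  exact Finset.le_sup' (fun j : ℕ => (∑ i ∈ Finset.range (j + 1), g (m - i)) / ((j : ℝ) + 1))
    (Finset.mem_range.2 (by lia))

lemma leftMaximal_nonneg {g : ℕ → ℝ} (hg : ∀ n, 0 ≤ g n) (m : ℕ) : 0 ≤ leftMaximal g m := by
  have := sum_window_le_leftMaximal g (Nat.zero_le m)
  simp only [zero_add, Finset.sum_range_one, Nat.sub_zero, Nat.cast_zero, one_mul] at this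
  exact (hg m).trans this

lemma lt_leftMaximal_iff (g : ℕ → ℝ) (t : ℝ) (m : ℕ) :
    t < leftMaximal g m ↔ 0 < maxExcess g t (m + 1) := by
  have hsum (j : ℕ) : ∑ i ∈ Finset.range (j + 1), (g (m - i) - t)
      = ∑ i ∈ Finset.range (j + 1), g (m - i) - (j + 1) * t := by
    rw [Finset.sum_sub_distrib]; simp
  constructor
  · intro h
    obtain ⟨j, hj, hlt⟩ := (Finset.lt_sup'_iff _).1 h
    rw [lt_div_iff₀ (by positivity)] at hlt
    have := sum_window_le_maxExcess g t m j (by simpa [Nat.lt_succ_iff] using hj)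
    rw [hsum] at this
    linarith
  · intro h
    obtain ⟨j, hj, heq⟩ := exists_sum_window_eq_maxExcess g t m h
    refine (Finset.lt_sup'_iff _).2 ⟨j, Finset.mem_range.2 (by lia), ?_⟩
    rw [lt_div_iff₀ (by positivity)]
    rw [hsum] at heq
    linarith

/-- The maximal ergodic theorem for the one-sided maximal function. -/
lemma sum_sub_nonneg_of_lt_leftMaximal (g : ℕ → ℝ) (t : ℝ) (L : ℕ) :
    0 ≤ ∑ n ∈ Finset.range L with t < leftMaximal g n, (g n - t) := by
  have hle : ∑ n ∈ Finset.range L, (maxExcess g t (n + 1) - maxExcess g t n)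
      ≤ ∑ n ∈ Finset.range L with t < leftMaximal g n, (g n - t) := by
    rw [Finset.sum_filter]
    refine Finset.sum_le_sum fun n _ => ?_
    simp only [lt_leftMaximal_iff]
    split_ifs with h
    · rw [maxExcess] at h ⊢
      have hpos : 0 < g n - t + maxExcess g t n := by simpa using h
      rw [max_eq_right hpos.le]
      linarith
    · linarith [maxExcess_nonneg g t n]
  rw [Finset.sum_range_sub] at hle
  have h0 : maxExcess g t 0 = 0 := rfl
  linarith [maxExcess_nonneg g t L]

/-- The Hardy–Littlewood maximal inequality in `ℓ^r`. -/
lemma sum_leftMaximal_rpow_le {r : ℝ} (hr : 1 < r) {g : ℕ → ℝ} (hg : ∀ n, 0 ≤ g n) (L : ℕ) :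
    ∑ n ∈ Finset.range L, leftMaximal g n ^ r
      ≤ (r / (r - 1)) ^ r * ∑ n ∈ Finset.range L, g n ^ r := by
  have hconj : r.HolderConjugate (r / (r - 1)) := Real.HolderConjugate.conjExponent hr
  have hM := leftMaximal_nonneg hg
  have hr1 : 0 < r - 1 := by linarith
  refine le_rpow_mul_of_le_mul_rpow hconj (Finset.sum_nonneg fun n _ => Real.rpow_nonneg (hM n) r)
    (Finset.sum_nonneg fun n _ => Real.rpow_nonneg (hg n) r) (by positivity) ?_
  refine (sum_rpow_le_of_weak_type _ hr (fun n _ => hM n) fun t _ =>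
    sum_sub_nonneg_of_lt_leftMaximal g t L).trans ?_
  gcongr
  have := Real.inner_le_Lp_mul_Lq_of_nonneg (Finset.range L) hconj (f := g)
    (g := fun n => leftMaximal g n ^ (r - 1)) (fun n _ => hg n)
    fun n _ => Real.rpow_nonneg (hM n) _
  refine this.trans_eq ?_
  rw [mul_comm]
  congr 2
  refine Finset.sum_congr rfl fun n _ => ?_
  rw [← Real.rpow_mul (hM n), mul_div_cancel₀ _ hr1.ne']

/-- Abel summation: a nonnegative antitone weight preserves nonnegativity of partial sums. -/
lemma sum_antitone_mul_nonneg {k h : ℕ → ℝ} (hk : Antitone k) (hk0 : ∀ n, 0 ≤ k n) (L : ℕ)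
    (hh : ∀ j ≤ L, 0 ≤ ∑ i ∈ Finset.range (j + 1), h i) :
    0 ≤ ∑ i ∈ Finset.range (L + 1), k i * h i := by
  have key : k L * ∑ i ∈ Finset.range (L + 1), h i ≤ ∑ i ∈ Finset.range (L + 1), k i * h i := by
    induction L with
    | zero => simp
    | succ L ih =>
      rw [Finset.sum_range_succ, Finset.sum_range_succ _ (L + 1), mul_add]
      gcongr
      refine (mul_le_mul_of_nonneg_right (hk L.le_succ) (hh L L.le_succ)).trans
        (ih fun j hj => hh j (hj.trans L.le_succ))
  exact (mul_nonneg (hk0 L) (hh L le_rfl)).trans key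

lemma sum_antitone_mul_le_leftMaximal {k g : ℕ → ℝ} (hk : Antitone k) (hk0 : ∀ n, 0 ≤ k n)
    (hk1 : ∀ n, ∑ i ∈ Finset.range n, k i ≤ 1) (hg : ∀ n, 0 ≤ g n) (m : ℕ) :
    ∑ i ∈ Finset.range (m + 1), k i * g (m - i) ≤ leftMaximal g m := by
  have h := sum_antitone_mul_nonneg (h := fun i => leftMaximal g m - g (m - i)) hk hk0 m
    fun j hj => by
      have := sum_window_le_leftMaximal g hj
      rw [Finset.sum_sub_distrib]
      simpa using this
  simp only [mul_sub, Finset.sum_sub_distrib, ← Finset.sum_mul] at h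
  have := mul_le_mul_of_nonneg_right (hk1 (m + 1)) (leftMaximal_nonneg hg m)
  linarith

/-- The lower triangular Toeplitz matrix of the sequence `k`. -/
def toeplitz (k : ℕ → ℝ) (n j : ℕ) : ℝ := if j ≤ n then k (n - j) else 0

lemma sum_toeplitz_mul {R : Type*} [CommSemiring R] (φ : ℝ →+* R) (k : ℕ → ℝ) (g : ℕ → R)
    {L n : ℕ} (hn : n < L) :
    ∑ j ∈ Finset.range L, φ (toeplitz k n j) * g j
      = ∑ j ∈ Finset.range (n + 1), φ (k (n - j)) * g j := by
  rw [← Finset.sum_subset (Finset.range_subset_range.2 hn)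
    fun j _ hj => by
      have : ¬ j ≤ n := fun h => hj (Finset.mem_range.2 (by lia))
      simp [toeplitz, this]]
  refine Finset.sum_congr rfl fun j hj => ?_
  rw [toeplitz, if_pos (Nat.lt_succ_iff.1 (Finset.mem_range.1 hj))]

lemma sum_toeplitz_row (k g : ℕ → ℝ) {L n : ℕ} (hn : n < L) :
    ∑ j ∈ Finset.range L, toeplitz k n j * g j
      = ∑ i ∈ Finset.range (n + 1), k i * g (n - i) := by
  have := sum_toeplitz_mul (RingHom.id ℝ) k g hn
  simp only [RingHom.id_apply] at this
  rw [this, ← Finset.sum_flip]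
  refine Finset.sum_congr rfl fun i hi => ?_
  rw [Nat.sub_sub_self (Nat.lt_succ_iff.1 (Finset.mem_range.1 hi))]

lemma sum_toeplitz_col (k g : ℕ → ℝ) {L j : ℕ} (hj : j < L) :
    ∑ n ∈ Finset.range L, toeplitz k n j * g n
      = ∑ i ∈ Finset.range L, toeplitz k (L - 1 - j) i * g (L - 1 - i) := by
  rw [← Finset.sum_range_reflect]
  refine Finset.sum_congr rfl fun i hi => ?_
  have hi := Finset.mem_range.1 hi
  congr 1
  by_cases h : j ≤ L - 1 - i
  · rw [toeplitz, toeplitz, if_pos h, if_pos (by lia)]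
    congr 1
    lia
  · rw [toeplitz, toeplitz, if_neg h, if_neg (by lia)]

/-- A family of nonnegative doubly substochastic matrices whose transposes are dominated,
uniformly in the family, by a maximal operator bounded on every `ℓ^r`, `r > 1`. -/
structure IsMaximallyBounded {ι : Type*} (κ : ι → ℕ → ℕ → ℝ) (L : ℕ) : Prop where
  nonneg : ∀ i n j, 0 ≤ κ i n j
  row_le : ∀ i, ∀ n < L, ∑ j ∈ Finset.range L, κ i n j ≤ 1
  col_le : ∀ i, ∀ j < L, ∑ n ∈ Finset.range L, κ i n j ≤ 1
  maximal : ∀ r : ℝ, 1 < r → ∀ g : ℕ → ℝ, (∀ n, 0 ≤ g n) → ∃ M : ℕ → ℝ, (∀ n, 0 ≤ M n) ∧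
    (∀ i, ∀ j < L, ∑ n ∈ Finset.range L, κ i n j * g n ≤ M j) ∧
    ∑ j ∈ Finset.range L, M j ^ r ≤ (r / (r - 1)) ^ r * ∑ n ∈ Finset.range L, g n ^ r

section Toeplitz

variable {ι : Type*} {k : ι → ℕ → ℝ}

lemma sum_toeplitz_row_le_one (hk1 : ∀ i n, ∑ j ∈ Finset.range n, k i j ≤ 1) (i : ι)
    {L n : ℕ} (hn : n < L) :
    ∑ j ∈ Finset.range L, toeplitz (k i) n j ≤ 1 := by
  have := sum_toeplitz_row (k i) (fun _ => 1) hn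
  simp only [mul_one] at this
  exact this.trans_le (hk1 i _)

lemma sum_toeplitz_col_le_one (hk1 : ∀ i n, ∑ j ∈ Finset.range n, k i j ≤ 1) (i : ι)
    {L j : ℕ} (hj : j < L) :
    ∑ n ∈ Finset.range L, toeplitz (k i) n j ≤ 1 := by
  have := sum_toeplitz_col (k i) (fun _ => 1) hj
  simp only [mul_one] at this
  exact this.trans_le (sum_toeplitz_row_le_one hk1 i (by lia))

lemma toeplitz_nonneg (hk0 : ∀ i n, 0 ≤ k i n) (i : ι) (n j : ℕ) : 0 ≤ toeplitz (k i) n j := by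
  rw [toeplitz]
  split_ifs
  exacts [hk0 _ _, le_rfl]

lemma isMaximallyBounded_toeplitz_transpose (hk : ∀ i, Antitone (k i)) (hk0 : ∀ i n, 0 ≤ k i n)
    (hk1 : ∀ i n, ∑ j ∈ Finset.range n, k i j ≤ 1) (L : ℕ) :
    IsMaximallyBounded (fun i n j => toeplitz (k i) j n) L where
  nonneg i n j := toeplitz_nonneg hk0 i j n
  row_le i n hn := sum_toeplitz_col_le_one hk1 i hn
  col_le i j hj := sum_toeplitz_row_le_one hk1 i hj
  maximal r hr g hg := by
    refine ⟨leftMaximal g, leftMaximal_nonneg hg, fun i j hj => ?_, sum_leftMaximal_rpow_le hr hg L⟩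
    rw [sum_toeplitz_row _ _ hj]
    exact sum_antitone_mul_le_leftMaximal (hk i) (hk0 i) (hk1 i) hg j

lemma isMaximallyBounded_toeplitz (hk : ∀ i, Antitone (k i)) (hk0 : ∀ i n, 0 ≤ k i n)
    (hk1 : ∀ i n, ∑ j ∈ Finset.range n, k i j ≤ 1) (L : ℕ) :
    IsMaximallyBounded (fun i => toeplitz (k i)) L where
  nonneg := toeplitz_nonneg hk0
  row_le i n hn := sum_toeplitz_row_le_one hk1 i hn
  col_le i j hj := sum_toeplitz_col_le_one hk1 i hj
  maximal r hr g hg := by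
    set h : ℕ → ℝ := fun n => g (L - 1 - n)
    have hh : ∀ n, 0 ≤ h n := fun n => hg _
    refine ⟨fun n => leftMaximal h (L - 1 - n), fun n => leftMaximal_nonneg hh _,
      fun i j hj => ?_, ?_⟩
    · rw [sum_toeplitz_col _ _ hj, sum_toeplitz_row _ h (by lia)]
      exact sum_antitone_mul_le_leftMaximal (hk i) (hk0 i) (hk1 i) hh _
    · rw [Finset.sum_range_reflect (fun n => leftMaximal h n ^ r),
        ← Finset.sum_range_reflect (fun n => g n ^ r)]
      exact sum_leftMaximal_rpow_le hr hh L

end Toeplitz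

section SquareFunction

variable {ι : Type*}

/-- The matrices `κ i` acting coordinatewise on a vector-valued sequence. -/
noncomputable def kernelSum (κ : ι → ℕ → ℕ → ℝ) (L : ℕ) (x : ℕ → EuclideanSpace ℂ ι) (n : ℕ) :
    EuclideanSpace ℂ ι :=
  WithLp.toLp 2 fun i => ∑ j ∈ Finset.range L, (κ i n j : ℂ) * x j i

lemma IsMaximallyBounded.norm_kernelSum_apply_sq_le {κ : ι → ℕ → ℕ → ℝ} {L : ℕ}
    (hκ : IsMaximallyBounded κ L) (x : ℕ → EuclideanSpace ℂ ι) {n : ℕ} (hn : n < L) (i : ι) :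
    ‖kernelSum κ L x n i‖ ^ 2 ≤ ∑ j ∈ Finset.range L, κ i n j * ‖x j i‖ ^ 2 := by
  have hk := hκ.nonneg i n
  have h1 : ‖kernelSum κ L x n i‖ ≤ ∑ j ∈ Finset.range L, κ i n j * ‖x j i‖ := by
    refine (norm_sum_le (Finset.range L) fun j => (κ i n j : ℂ) * x j i).trans_eq
      (Finset.sum_congr rfl fun j _ => ?_)
    rw [norm_mul, Complex.norm_real, Real.norm_of_nonneg (hk j)]
  have hs : 0 ≤ ∑ j ∈ Finset.range L, κ i n j * ‖x j i‖ ^ 2 :=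
    Finset.sum_nonneg fun j _ => mul_nonneg (hk j) (by positivity)
  calc ‖kernelSum κ L x n i‖ ^ 2 ≤ (∑ j ∈ Finset.range L, κ i n j * ‖x j i‖) ^ 2 := by gcongr
    _ ≤ (∑ j ∈ Finset.range L, κ i n j) * ∑ j ∈ Finset.range L, κ i n j * ‖x j i‖ ^ 2 :=
        Finset.sum_sq_le_sum_mul_sum_of_sq_le_mul _ (fun j _ => hk j)
          (fun j _ => mul_nonneg (hk j) (by positivity)) fun j _ => by ring_nf; rfl
    _ ≤ 1 * ∑ j ∈ Finset.range L, κ i n j * ‖x j i‖ ^ 2 := by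
        gcongr
        exact hκ.row_le i n hn
    _ = _ := one_mul _

variable [Fintype ι]

lemma IsMaximallyBounded.sum_mul_norm_kernelSum_sq_le {κ : ι → ℕ → ℕ → ℝ} {L : ℕ}
    (hκ : IsMaximallyBounded κ L) (x : ℕ → EuclideanSpace ℂ ι) {g M : ℕ → ℝ}
    (hg : ∀ n, 0 ≤ g n)
    (hM : ∀ i, ∀ j < L, ∑ n ∈ Finset.range L, κ i n j * g n ≤ M j) :
    ∑ n ∈ Finset.range L, g n * ‖kernelSum κ L x n‖ ^ 2
      ≤ ∑ j ∈ Finset.range L, ‖x j‖ ^ 2 * M j := by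
  calc ∑ n ∈ Finset.range L, g n * ‖kernelSum κ L x n‖ ^ 2
      ≤ ∑ n ∈ Finset.range L, g n * ∑ i, ∑ j ∈ Finset.range L, κ i n j * ‖x j i‖ ^ 2 := by
        refine Finset.sum_le_sum fun n hn => mul_le_mul_of_nonneg_left ?_ (hg n)
        rw [EuclideanSpace.norm_sq_eq]
        exact Finset.sum_le_sum fun i _ =>
          hκ.norm_kernelSum_apply_sq_le x (Finset.mem_range.1 hn) i
    _ = ∑ j ∈ Finset.range L, ∑ i, ‖x j i‖ ^ 2 * ∑ n ∈ Finset.range L, κ i n j * g n := by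
        simp only [Finset.mul_sum]
        rw [Finset.sum_comm' (t' := Finset.univ) (s' := fun _ => Finset.range L) (by simp)]
        rw [Finset.sum_comm' (t' := Finset.univ) (s' := fun _ => Finset.range L) (by simp)]
        refine Finset.sum_congr rfl fun i _ => ?_
        rw [Finset.sum_comm]
        exact Finset.sum_congr rfl fun j _ => Finset.sum_congr rfl fun n _ => by ring
    _ ≤ ∑ j ∈ Finset.range L, ∑ i, ‖x j i‖ ^ 2 * M j := by
        refine Finset.sum_le_sum fun j hj => Finset.sum_le_sum fun i _ => ?_
        exact mul_le_mul_of_nonneg_left (hM i j (Finset.mem_range.1 hj)) (by positivity)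
    _ = _ := by simp only [EuclideanSpace.norm_sq_eq, Finset.sum_mul]

lemma sq_rpow_half {a p : ℝ} (ha : 0 ≤ a) : (a ^ 2) ^ (p / 2) = a ^ p := by
  rw [← Real.rpow_natCast, ← Real.rpow_mul ha]
  congr 1
  push_cast
  ring

/-- The square function estimate for `p ≥ 2`. -/
lemma IsMaximallyBounded.sum_norm_kernelSum_rpow_le {κ : ι → ℕ → ℕ → ℝ} {L : ℕ} {p : ℝ}
    (hκ : IsMaximallyBounded κ L) (hp : 2 ≤ p) (x : ℕ → EuclideanSpace ℂ ι) :
    ∑ n ∈ Finset.range L, ‖kernelSum κ L x n‖ ^ p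
      ≤ (p / 2) ^ (p / 2) * ∑ n ∈ Finset.range L, ‖x n‖ ^ p := by
  rcases hp.eq_or_lt with rfl | hp
  · have := hκ.sum_mul_norm_kernelSum_sq_le x (g := fun _ => 1) (M := fun _ => 1)
      (fun _ => zero_le_one) (fun i j hj => by simpa using hκ.col_le i j hj)
    simpa using this
  set q := p / 2 with hq
  have hq1 : 1 < q := by rw [hq]; linarith
  have hq1' : 0 < q - 1 := by linarith
  set r := q / (q - 1) with hr
  have hqr : q.HolderConjugate r := Real.HolderConjugate.conjExponent hq1
  have hr1 : 1 < r := hqr.symm.lt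
  have hrq : r / (r - 1) = q := hqr.symm.conjugate_eq.symm
  set F : ℕ → ℝ := fun n => ‖kernelSum κ L x n‖ ^ 2 with hF
  have hF0 : ∀ n, 0 ≤ F n := fun n => by positivity
  set w : ℕ → ℝ := fun n => ‖x n‖ ^ 2 with hw
  have hw0 : ∀ n, 0 ≤ w n := fun n => by positivity
  suffices ∑ n ∈ Finset.range L, F n ^ q ≤ q ^ q * ∑ n ∈ Finset.range L, w n ^ q by
    simpa only [hF, hw, hq, sq_rpow_half (norm_nonneg _)] using this
  have hA : 0 ≤ ∑ n ∈ Finset.range L, F n ^ q :=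
    Finset.sum_nonneg fun n _ => Real.rpow_nonneg (hF0 n) _
  refine le_rpow_mul_of_le_mul_rpow hqr hA
    (Finset.sum_nonneg fun n _ => Real.rpow_nonneg (hw0 n) _) (by linarith) ?_
  obtain ⟨M, hM0, hM, hMr⟩ := hκ.maximal r hr1 (fun n => F n ^ (q - 1))
    fun n => Real.rpow_nonneg (hF0 n) _
  have hgr : ∑ n ∈ Finset.range L, (F n ^ (q - 1)) ^ r = ∑ n ∈ Finset.range L, F n ^ q := by
    refine Finset.sum_congr rfl fun n _ => ?_
    rw [← Real.rpow_mul (hF0 n), hr, mul_div_cancel₀ _ hq1'.ne']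
  rw [hgr, hrq] at hMr
  have hMA : (∑ n ∈ Finset.range L, M n ^ r) ^ (1 / r)
      ≤ q * (∑ n ∈ Finset.range L, F n ^ q) ^ (1 / r) := by
    have hr0 : 0 < r := by linarith
    calc _ ≤ (q ^ r * ∑ n ∈ Finset.range L, F n ^ q) ^ (1 / r) :=
          Real.rpow_le_rpow (Finset.sum_nonneg fun n _ => Real.rpow_nonneg (hM0 n) _) hMr
            (by positivity)
      _ = _ := by
          rw [Real.mul_rpow (by positivity) hA, ← Real.rpow_mul (by linarith),
            mul_one_div_cancel hr0.ne', Real.rpow_one]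
  calc ∑ n ∈ Finset.range L, F n ^ q = ∑ n ∈ Finset.range L, F n ^ (q - 1) * F n := by
        refine Finset.sum_congr rfl fun n _ => ?_
        rw [← Real.rpow_add_one' (hF0 n) (by linarith), sub_add_cancel]
    _ ≤ ∑ j ∈ Finset.range L, w j * M j :=
        hκ.sum_mul_norm_kernelSum_sq_le x (fun n => Real.rpow_nonneg (hF0 n) _) hM
    _ ≤ (∑ j ∈ Finset.range L, w j ^ q) ^ (1 / q) * (∑ j ∈ Finset.range L, M j ^ r) ^ (1 / r) :=
        Real.inner_le_Lp_mul_Lq_of_nonneg _ hqr (fun n _ => hw0 n) fun n _ => hM0 n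
    _ ≤ (∑ j ∈ Finset.range L, w j ^ q) ^ (1 / q)
          * (q * (∑ n ∈ Finset.range L, F n ^ q) ^ (1 / r)) := by gcongr
    _ = _ := by ring

lemma sum_inner_kernelSum (κ : ι → ℕ → ℕ → ℝ) (L : ℕ) (x y : ℕ → EuclideanSpace ℂ ι) :
    ∑ n ∈ Finset.range L, inner ℂ (y n) (kernelSum κ L x n)
      = ∑ j ∈ Finset.range L, inner ℂ (kernelSum (fun i n j => κ i j n) L y j) (x j) := by
  simp only [PiLp.inner_apply, kernelSum, RCLike.inner_apply, map_sum, map_mul, Complex.conj_ofReal,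
    Finset.sum_mul, Finset.mul_sum]
  rw [Finset.sum_comm, Finset.sum_comm (s := Finset.range L) (t := Finset.univ)]
  refine Finset.sum_congr rfl fun i _ => ?_
  rw [Finset.sum_comm]
  exact Finset.sum_congr rfl fun j _ => Finset.sum_congr rfl fun n _ => by ring

/-- A matrix action whose transpose is bounded on `ℓ^q` is bounded on the dual `ℓ^p`. -/
lemma sum_norm_kernelSum_rpow_le_of_transpose {κ : ι → ℕ → ℕ → ℝ} {L : ℕ} {p q D : ℝ}
    (hpq : p.HolderConjugate q) (hD : 0 ≤ D)
    (hT : ∀ y : ℕ → EuclideanSpace ℂ ι,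
      ∑ n ∈ Finset.range L, ‖kernelSum (fun i n j => κ i j n) L y n‖ ^ q
        ≤ D * ∑ n ∈ Finset.range L, ‖y n‖ ^ q)
    (x : ℕ → EuclideanSpace ℂ ι) :
    ∑ n ∈ Finset.range L, ‖kernelSum κ L x n‖ ^ p
      ≤ (D ^ (1 / q)) ^ p * ∑ n ∈ Finset.range L, ‖x n‖ ^ p := by
  set z := kernelSum κ L x with hz
  set y : ℕ → EuclideanSpace ℂ ι := fun n => ((‖z n‖ ^ (p - 2) : ℝ) : ℂ) • z n with hy
  have hp1 := hpq.lt
  have hA : 0 ≤ ∑ n ∈ Finset.range L, ‖z n‖ ^ p := Finset.sum_nonneg fun n _ => by positivity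
  have hyz (n : ℕ) : inner ℂ (y n) (z n) = ((‖z n‖ ^ p : ℝ) : ℂ) := by
    rw [hy, inner_smul_left, inner_self_eq_norm_sq_to_K, Complex.conj_ofReal]
    have : ‖z n‖ ^ p = ‖z n‖ ^ (p - 2) * ‖z n‖ ^ 2 := by
      rw [← Real.rpow_natCast, ← Real.rpow_add' (norm_nonneg _) (by push_cast; linarith)]
      push_cast
      rw [sub_add_cancel]
    rw [this]
    push_cast
    rfl
  have hyq (n : ℕ) : ‖y n‖ ^ q = ‖z n‖ ^ p := by
    have : ‖y n‖ = ‖z n‖ ^ (p - 1) := by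
      rw [hy, norm_smul, Complex.norm_real, Real.norm_of_nonneg (by positivity),
        ← Real.rpow_add_one' (norm_nonneg _) (by linarith)]
      congr 1
      ring
    rw [this, ← Real.rpow_mul (norm_nonneg _), hpq.sub_one_mul_conj]
  refine le_rpow_mul_of_le_mul_rpow hpq hA (Finset.sum_nonneg fun n _ => by positivity)
    (by positivity) ?_
  set S := kernelSum (fun i n j => κ i j n) L y with hS
  have hSA : (∑ n ∈ Finset.range L, ‖S n‖ ^ q) ^ (1 / q)
      ≤ D ^ (1 / q) * (∑ n ∈ Finset.range L, ‖z n‖ ^ p) ^ (1 / q) := by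
    have hq0 := hpq.symm.pos
    rw [← Real.mul_rpow hD hA]
    refine Real.rpow_le_rpow (Finset.sum_nonneg fun n _ => by positivity) ?_ (by positivity)
    simpa only [hyq] using hT y
  calc ∑ n ∈ Finset.range L, ‖z n‖ ^ p = ‖∑ n ∈ Finset.range L, inner ℂ (y n) (z n)‖ := by
        simp only [hyz]
        rw [← Complex.ofReal_sum, Complex.norm_real, Real.norm_of_nonneg hA]
    _ = ‖∑ j ∈ Finset.range L, inner ℂ (S j) (x j)‖ := by rw [hz, sum_inner_kernelSum]
    _ ≤ ∑ j ∈ Finset.range L, ‖S j‖ * ‖x j‖ :=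
        (norm_sum_le _ _).trans (Finset.sum_le_sum fun j _ => norm_inner_le_norm _ _)
    _ ≤ (∑ n ∈ Finset.range L, ‖S n‖ ^ q) ^ (1 / q)
          * (∑ n ∈ Finset.range L, ‖x n‖ ^ p) ^ (1 / p) :=
        Real.inner_le_Lp_mul_Lq_of_nonneg _ hpq.symm (fun _ _ => norm_nonneg _)
          fun _ _ => norm_nonneg _
    _ ≤ D ^ (1 / q) * (∑ n ∈ Finset.range L, ‖z n‖ ^ p) ^ (1 / q)
          * (∑ n ∈ Finset.range L, ‖x n‖ ^ p) ^ (1 / p) := by gcongr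
    _ = _ := by ring

end SquareFunction

/-- Antitone substochastic convolution kernels, one in each coordinate, are bounded on
vector-valued `ℓ^p` uniformly in the kernels and the dimension. -/
lemma exists_sum_norm_kernelSum_toeplitz_le {p : ℝ} (hp : 1 < p) :
    ∃ D : ℝ, 0 < D ∧ ∀ (ι : Type) [Fintype ι] (k : ι → ℕ → ℝ), (∀ i, Antitone (k i)) →
      (∀ i n, 0 ≤ k i n) → (∀ i n, ∑ j ∈ Finset.range n, k i j ≤ 1) →
      ∀ (L : ℕ) (x : ℕ → EuclideanSpace ℂ ι),
        ∑ n ∈ Finset.range L, ‖kernelSum (fun i => toeplitz (k i)) L x n‖ ^ p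
          ≤ D * ∑ n ∈ Finset.range L, ‖x n‖ ^ p := by
  rcases le_or_gt 2 p with h2 | h2
  · exact ⟨(p / 2) ^ (p / 2), by positivity, fun ι _ k hk hk0 hk1 L x =>
      (isMaximallyBounded_toeplitz hk hk0 hk1 L).sum_norm_kernelSum_rpow_le h2 x⟩
  · set q := p / (p - 1)
    have hpq : p.HolderConjugate q := Real.HolderConjugate.conjExponent hp
    have hq2 : 2 ≤ q := by
      rw [le_div_iff₀ (by linarith)]
      linarith
    exact ⟨(((q / 2) ^ (q / 2)) ^ (1 / q)) ^ p, by positivity, fun ι _ k hk hk0 hk1 L x =>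
      sum_norm_kernelSum_rpow_le_of_transpose hpq (by positivity)
        (fun y => (isMaximallyBounded_toeplitz_transpose hk hk0 hk1
          L).sum_norm_kernelSum_rpow_le hq2 y) x⟩

lemma sum_Icc_one_eq_sum_range {R : Type*} [AddCommMonoid R] (φ : ℕ → R) (n : ℕ) :
    ∑ j ∈ Finset.Icc 1 n, φ j = ∑ m ∈ Finset.range n, φ (m + 1) := by
  rw [Finset.range_eq_Ico, Finset.sum_Ico_add' φ 0 n 1]
  rfl

/-- In an eigenbasis of `A`, the scheme is solved coordinatewise by the resolvent kernels. -/
lemma repr_apply_eq_kernelSum {V : Type} [NormedAddCommGroup V] [InnerProductSpace ℂ V]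
    {ι : Type} [Fintype ι] (e : OrthonormalBasis ι ℂ V) (A : V →L[ℂ] V) (l : ι → ℝ)
    (hl : ∀ i, 0 < l i) (hA : ∀ v i, e.repr (A v) i = l i * e.repr v i)
    {α τ : ℝ} (hτ : 0 < τ) {f U : ℕ → V} (hU : U 0 = 0) {L : ℕ}
    (h : ∀ n, 1 ≤ n → n ≤ L → cqDeriv α τ U n + A (U n) = f n) {n : ℕ} (hn : n < L) :
    e.repr (A (U (n + 1))) = kernelSum (fun i => toeplitz (resolventKernel α (l i * τ ^ α))) L
      (fun m => e.repr (f (m + 1))) n := by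
  have hτα : 0 < τ ^ α := by positivity
  ext i
  have hμ : 0 < l i * τ ^ α := mul_pos (hl i) hτα
  have hscalar : ∀ m < L, ∑ j ∈ Finset.range (m + 2), (cqWeight α j : ℂ) * e.repr (U (m + 1 - j)) i
      + (l i * τ ^ α : ℝ) * e.repr (U (m + 1)) i = (τ ^ α : ℝ) * e.repr (f (m + 1)) i := by
    intro m hm
    have hinv : ((τ ^ α : ℝ) : ℂ) * ((τ ^ (-α) : ℝ) : ℂ) = 1 := by
      rw [← Complex.ofReal_mul, ← Real.rpow_add hτ, add_neg_cancel, Real.rpow_zero,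
        Complex.ofReal_one]
    have hcq : e.repr (cqDeriv α τ U (m + 1)) i = ((τ ^ (-α) : ℝ) : ℂ) *
        ∑ j ∈ Finset.range (m + 2), (cqWeight α j : ℂ) * e.repr (U (m + 1 - j)) i := by
      simp only [cqDeriv, ← Complex.coe_smul, map_smul, map_sum, PiLp.smul_apply, smul_eq_mul,
        WithLp.ofLp_sum, Finset.sum_apply, WithLp.ofLp_smul, Pi.smul_apply]
    rw [← h (m + 1) (by lia) (by lia), map_add, PiLp.add_apply, hcq, hA]
    rw [mul_add, ← mul_assoc, hinv]
    push_cast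
    ring
  have hsol := mul_eq_sum_resolventKernel (α := α) hμ (u := fun m => e.repr (U m) i) (by simp [hU])
    hscalar hn
  have hτne : ((τ ^ α : ℝ) : ℂ) ≠ 0 := Complex.ofReal_ne_zero.2 hτα.ne'
  refine mul_left_cancel₀ hτne ?_
  rw [hA]
  have hsum := sum_toeplitz_mul Complex.ofRealHom (resolventKernel α (l i * τ ^ α))
    (fun m => e.repr (f (m + 1)) i) hn
  simp only [Complex.ofRealHom_eq_coe] at hsum
  refine Eq.trans ?_ (congrArg (((τ ^ α : ℝ) : ℂ) * ·) hsum.symm)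
  simp only [Finset.mul_sum]
  calc _ = ((l i * τ ^ α : ℝ) : ℂ) * e.repr (U (n + 1)) i := by push_cast; ring
    _ = _ := hsol
    _ = _ := Finset.sum_congr rfl fun j _ => by ring

/-- Maximal `ℓ^p` regularity of the backward Euler CQ scheme. -/
theorem maximal_lp_regularity (α p : ℝ) (hα0 : 0 < α) (hα1 : α < 1) (hp : 1 < p) :
    ∃ c : ℝ, 0 < c ∧
      ∀ (V : Type) (_ : NormedAddCommGroup V) (_ : InnerProductSpace ℂ V)
        (_ : FiniteDimensional ℂ V) (_ : Nontrivial V)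
        (A : V →L[ℂ] V), IsSelfAdjoint A →
        (∀ x : V, x ≠ 0 → 0 < (⟪A x, x⟫).re) →
        ∀ τ : ℝ, 0 < τ → ∀ N : ℕ, 1 ≤ N → ∀ (f U : ℕ → V), U 0 = 0 →
        (∀ n : ℕ, 1 ≤ n → n ≤ N → cqDeriv α τ U n + A (U n) = f n) →
        ∀ n : ℕ, 1 ≤ n → n ≤ N →
          (τ * ∑ j ∈ Finset.Icc 1 n, ‖cqDeriv α τ U j‖ ^ p) ^ (1 / p)
            + (τ * ∑ j ∈ Finset.Icc 1 n, ‖A (U j)‖ ^ p) ^ (1 / p)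
          ≤ c * (τ * ∑ j ∈ Finset.Icc 1 n, ‖f j‖ ^ p) ^ (1 / p) := by
  obtain ⟨D, hD, hbound⟩ := exists_sum_norm_kernelSum_toeplitz_le hp
  refine ⟨1 + 2 * D ^ (1 / p), by positivity, ?_⟩
  intro V _ _ _ _ A hA hpos τ hτ N _ f U hU hscheme n _ hnN
  have hsymm : (A : V →ₗ[ℂ] V).IsSymmetric := hA.isSymmetric
  set e := hsymm.eigenvectorBasis rfl
  set l := hsymm.eigenvalues rfl
  have hrepr (v : V) (i) : e.repr (A v) i = l i * e.repr v i :=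
    hsymm.eigenvectorBasis_apply_self_apply rfl v i
  have hl (i) : 0 < l i := by
    have h := hpos (e i) (e.orthonormal.ne_zero i)
    have hAe : A (e i) = (l i : ℂ) • e i := hsymm.apply_eigenvectorBasis rfl i
    rw [hAe, inner_smul_left, inner_self_eq_norm_sq_to_K, e.orthonormal.norm_eq_one] at h
    simpa using h
  have hsol {m : ℕ} (hm : m < n) := repr_apply_eq_kernelSum e A l hl hrepr hτ hU
    (fun j hj hjn => hscheme j hj (hjn.trans hnN)) hm
  have hAU : ∑ j ∈ Finset.Icc 1 n, ‖A (U j)‖ ^ p ≤ D * ∑ j ∈ Finset.Icc 1 n, ‖f j‖ ^ p := by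
    have h := hbound _ (fun i => resolventKernel α (l i * τ ^ α))
      (fun i => resolventKernel_antitone hα0 hα1 (mul_pos (hl i) (by positivity)))
      (fun i => resolventKernel_nonneg hα0 hα1 (mul_pos (hl i) (by positivity)))
      (fun i => sum_resolventKernel_le_one hα0 hα1 (mul_pos (hl i) (by positivity)))
      n (fun m => e.repr (f (m + 1)))
    simp only [e.repr.norm_map] at h
    rw [sum_Icc_one_eq_sum_range, sum_Icc_one_eq_sum_range]
    refine (Finset.sum_congr rfl fun m hm => ?_).trans_le h
    rw [← hsol (Finset.mem_range.1 hm), e.repr.norm_map]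
  have hp0 : 0 < p := by linarith
  have hf0 : 0 ≤ ∑ j ∈ Finset.Icc 1 n, ‖f j‖ ^ p := Finset.sum_nonneg fun _ _ => by positivity
  have hA0 : 0 ≤ ∑ j ∈ Finset.Icc 1 n, ‖A (U j)‖ ^ p := Finset.sum_nonneg fun _ _ => by positivity
  have hd0 : 0 ≤ ∑ j ∈ Finset.Icc 1 n, ‖cqDeriv α τ U j‖ ^ p :=
    Finset.sum_nonneg fun _ _ => by positivity
  have hAU' : (∑ j ∈ Finset.Icc 1 n, ‖A (U j)‖ ^ p) ^ (1 / p)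
      ≤ D ^ (1 / p) * (∑ j ∈ Finset.Icc 1 n, ‖f j‖ ^ p) ^ (1 / p) := by
    rw [← Real.mul_rpow hD.le hf0]
    gcongr
  have hdU : (∑ j ∈ Finset.Icc 1 n, ‖cqDeriv α τ U j‖ ^ p) ^ (1 / p)
      ≤ (∑ j ∈ Finset.Icc 1 n, ‖f j‖ ^ p) ^ (1 / p)
        + (∑ j ∈ Finset.Icc 1 n, ‖A (U j)‖ ^ p) ^ (1 / p) := by
    refine le_trans ?_ (Real.Lp_add_le_of_nonneg (Finset.Icc 1 n) hp.le
      (fun _ _ => norm_nonneg _) fun _ _ => norm_nonneg _)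
    gcongr with j hj
    obtain ⟨hj1, hjn⟩ := Finset.mem_Icc.1 hj
    rw [eq_sub_of_add_eq (hscheme j hj1 (hjn.trans hnN))]
    exact norm_sub_le _ _
  rw [Real.mul_rpow hτ.le hd0, Real.mul_rpow hτ.le hA0, Real.mul_rpow hτ.le hf0]
  have hτp : 0 ≤ τ ^ (1 / p) := by positivity
  nlinarith [mul_le_mul_of_nonneg_left hAU' hτp, mul_le_mul_of_nonneg_left hdU hτp]
end
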